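/- arXiv:2304.00657 — 2 statements merged into one kernel-verified Lean document; each statement's English description precedes it below -/
import Mathlib

section
/- Let N ≥ 1 and let λ₁, …, λ_N be positive real numbers with m = min_i λ_i and M = max_i λ_i. Then for every v = (v₁, …, v_N) ∈ ℝ^N one has Σ_{i=1}^N λ_i v_i² ≥ (2√(mM)/(m+M)) · (Σ_{i=1}^N λ_i² v_i²)^{1/2} · (Σ_{i=1}^N v_i²)^{1/2}. Moreover, if λ₁ = m and λ_N = M, then equality holds for the vector v = (√(M/(m+M)), 0, …, 0, √(m/(m+M))). -/
noncomputable section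

theorem cassels_aux_sum (k : ℕ) (f : Fin (k + 2) → ℝ) (a b : ℝ) :
    ∑ i : Fin (k + 2), f i * (if (i : ℕ) = 0 then a
      else if (i : ℕ) = k + 2 - 1 then b else 0) ^ 2
      = f 0 * a ^ 2 + f (Fin.last (k + 1)) * b ^ 2 := by
  rw [Fin.sum_univ_succ, Fin.sum_univ_castSucc]
  have h : ∀ i : Fin k, (i : ℕ) ≠ k := fun i => i.2.ne
  simp [h]

/-- Weighted Cassels-type inequality: if `0 < m = min_i λ_i` and `M = max_i λ_i`, then
`Σ λ_i v_i² ≥ (2√(mM)/(m+M)) (Σ λ_i² v_i²)^{1/2} (Σ v_i²)^{1/2}`, with equality (when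
`λ_1 = m` and `λ_N = M`) at the vector `(√(M/(m+M)), 0, …, 0, √(m/(m+M)))`. -/
theorem cassels_weighted_eigenvalue_inequality
    (N : ℕ) (hN : 1 ≤ N) (lam : Fin N → ℝ) (hpos : ∀ i, 0 < lam i)
    (m M : ℝ)
    (hm : ∀ i, m ≤ lam i) (hm' : ∃ i, lam i = m)
    (hM : ∀ i, lam i ≤ M) (hM' : ∃ i, lam i = M) :
    (∀ v : Fin N → ℝ,
      2 * Real.sqrt (m * M) / (m + M) * Real.sqrt (∑ i, lam i ^ 2 * v i ^ 2) *
        Real.sqrt (∑ i, v i ^ 2) ≤ ∑ i, lam i * v i ^ 2) ∧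
    (lam ⟨0, by omega⟩ = m → lam ⟨N - 1, by omega⟩ = M →
      (fun v : Fin N → ℝ =>
        2 * Real.sqrt (m * M) / (m + M) * Real.sqrt (∑ i, lam i ^ 2 * v i ^ 2) *
          Real.sqrt (∑ i, v i ^ 2) = ∑ i, lam i * v i ^ 2)
        (fun i : Fin N => if (i : ℕ) = 0 then Real.sqrt (M / (m + M))
          else if (i : ℕ) = N - 1 then Real.sqrt (m / (m + M)) else 0)) := by
  have hm0 : 0 < m := by
    obtain ⟨i, hi⟩ := hm'
    exact hi ▸ hpos i
  have hM0 : 0 < M := by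
    obtain ⟨i, hi⟩ := hM'
    exact hi ▸ hpos i
  have hs : 0 < m + M := by positivity
  constructor
  · intro v
    have hA : 0 ≤ ∑ i, lam i ^ 2 * v i ^ 2 := Finset.sum_nonneg fun i _ => by positivity
    have hB : 0 ≤ ∑ i, v i ^ 2 := Finset.sum_nonneg fun i _ => by positivity
    have key : ∑ i, lam i ^ 2 * v i ^ 2 + m * M * ∑ i, v i ^ 2
        ≤ (m + M) * ∑ i, lam i * v i ^ 2 := by
      rw [Finset.mul_sum, Finset.mul_sum, ← Finset.sum_add_distrib]
      refine Finset.sum_le_sum fun i _ => ?_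
      have h1 := mul_nonneg (mul_nonneg (sub_nonneg.2 (hm i)) (sub_nonneg.2 (hM i)))
        (sq_nonneg (v i))
      nlinarith [h1]
    have h2 : 2 * Real.sqrt (m * M) * Real.sqrt (∑ i, lam i ^ 2 * v i ^ 2) *
        Real.sqrt (∑ i, v i ^ 2) ≤ (m + M) * ∑ i, lam i * v i ^ 2 := by
      refine le_trans ?_ key
      have e1 := Real.sq_sqrt hA
      have e2 := Real.sq_sqrt hB
      have e3 := Real.sq_sqrt (mul_pos hm0 hM0).le
      have e4 : (Real.sqrt (m * M) * Real.sqrt (∑ i, v i ^ 2)) ^ 2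
          = m * M * ∑ i, v i ^ 2 := by rw [mul_pow, e2, e3]
      have e5 := sq_nonneg (Real.sqrt (∑ i, lam i ^ 2 * v i ^ 2)
        - Real.sqrt (m * M) * Real.sqrt (∑ i, v i ^ 2))
      rw [sub_sq, e1, e4] at e5
      linarith
    rw [div_mul_eq_mul_div, div_mul_eq_mul_div, div_le_iff₀ hs]
    linarith
  · intro h0 h1
    have ea := Real.sq_sqrt (div_pos hM0 hs).le
    have eb := Real.sq_sqrt (div_pos hm0 hs).le
    match N, hN with
    | 1, _ =>
      have hmM : m = M := h0.symm.trans h1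
      subst hmM
      have h0' : lam 0 = m := h0
      have e : m / (m + m) = 1 / 2 := by field_simp; norm_num
      have ea' : Real.sqrt (1 / 2 : ℝ) ^ 2 = 1 / 2 := Real.sq_sqrt (by norm_num)
      have e6 : Real.sqrt (m ^ 2 * (1 / 2)) = m * Real.sqrt (1 / 2) := by
        rw [Real.sqrt_mul (by positivity), Real.sqrt_sq hm0.le]
      have e7 : Real.sqrt (1 / 2 : ℝ) * Real.sqrt (1 / 2) = 1 / 2 :=
        Real.mul_self_sqrt (by norm_num)
      simp only [Fin.sum_univ_one, Fin.val_zero, if_true, h0', e, ea', e6]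
      rw [Real.sqrt_mul_self hm0.le]
      calc _ = 2 * m / (m + m) * m * (Real.sqrt (1 / 2 : ℝ) * Real.sqrt (1 / 2)) := by ring
        _ = _ := by rw [e7]; field_simp; norm_num
    | k + 2, _ =>
      have h0' : lam 0 = m := h0
      have h1' : lam (Fin.last (k + 1)) = M := h1
      have s3 := cassels_aux_sum k (fun _ => 1) (Real.sqrt (M / (m + M))) (Real.sqrt (m / (m + M)))
      simp only [one_mul] at s3
      beta_reduce
      rw [s3, cassels_aux_sum k (fun i => lam i ^ 2), cassels_aux_sum k lam]
      simp only [ea, eb, h0', h1']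
      have e8 : m ^ 2 * (M / (m + M)) + M ^ 2 * (m / (m + M)) = m * M := by
        field_simp
      have e9 : M / (m + M) + m / (m + M) = 1 := by field_simp; ring
      rw [e8, e9, Real.sqrt_one, mul_one, div_mul_eq_mul_div, mul_assoc,
        Real.mul_self_sqrt (by positivity)]
      field_simp
      ring
end
end

section
/- Let N ≥ 2 and let F : ℝ^N → ℝ be convex and continuously differentiable with F(z) ≥ F(0) = 0 for all z, and assume the gradient map ∇F is a homeomorphism of ℝ^N onto ℝ^N. Define G = F ∘ (∇F)⁻¹. Then for every z ∈ ℝ^N the map t ↦ G(t z) is nondecreasing on [0, ∞); in particular, for every k ≥ 0 the sublevel set {z ∈ ℝ^N : G(z) ≤ k} is star-shaped with respect to the origin. -/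
open MeasureTheory Metric Set

noncomputable section

/-- `ℝ^N` with the Euclidean structure. -/
abbrev En (N : ℕ) := EuclideanSpace ℝ (Fin N)

theorem subgrad_aux {N : ℕ} {F : En N → ℝ} (hconv : ConvexOn ℝ Set.univ F)
    (hC1 : ContDiff ℝ 1 F) (x y : En N) :
    F x + inner ℝ (gradient F x) (y - x) ≤ F y := by
  have hd : HasFDerivAt F (fderiv ℝ F x) x :=
    ((hC1.differentiable one_ne_zero) x).hasFDerivAt
  have hin : inner ℝ (gradient F x) (y - x) = fderiv ℝ F x (y - x) := by
    simp [gradient]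
  have hl : HasDerivAt (fun r : ℝ => AffineMap.lineMap x y r) (y - x) 0 :=
    AffineMap.hasDerivAt_lineMap
  have hg : HasDerivAt (F ∘ AffineMap.lineMap x y) (fderiv ℝ F x (y - x)) (0 : ℝ) := by
    apply HasFDerivAt.comp_hasDerivAt (0 : ℝ) _ hl
    simpa using hd
  have hc : ConvexOn ℝ Set.univ (F ∘ (AffineMap.lineMap x y : ℝ →ᵃ[ℝ] En N)) := by
    simpa using hconv.comp_affineMap (AffineMap.lineMap x y : ℝ →ᵃ[ℝ] En N)
  have h := hc.le_slope_of_hasDerivAt (mem_univ 0) (mem_univ 1) one_pos hg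
  simp [slope_def_field] at h
  rw [hin, map_sub]
  linarith

/-- Star-shapedness part of Proposition 6.1 of the paper: if `F` is convex, `C¹`,
normalised (`F ≥ F(0) = 0`) and `∇F` is a homeomorphism with (continuous) inverse `Finv`,
then `t ↦ G(t z)` is nondecreasing on `[0, ∞)` for `G = F ∘ (∇F)⁻¹`, and in particular all
sublevel sets `{G ≤ k}`, `k ≥ 0`, are star-shaped with respect to the origin. -/
theorem G_radially_nondecreasing_and_starshaped
    (N : ℕ) (hN : 2 ≤ N) (F : En N → ℝ)
    (hconv : ConvexOn ℝ Set.univ F) (hC1 : ContDiff ℝ 1 F)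
    (hnorm : ∀ z, 0 ≤ F z) (hF0 : F 0 = 0)
    (Finv : En N → En N) (hFinvc : Continuous Finv)
    (hli : Function.LeftInverse Finv (gradient F))
    (hri : Function.RightInverse Finv (gradient F)) :
    (∀ z : En N, ∀ s t : ℝ, 0 ≤ s → s ≤ t → F (Finv (s • z)) ≤ F (Finv (t • z))) ∧
    (∀ k : ℝ, 0 ≤ k → ∀ z : En N, F (Finv z) ≤ k →
      ∀ t : ℝ, t ∈ Set.Icc (0 : ℝ) 1 → F (Finv (t • z)) ≤ k) := by
  have mono : ∀ z : En N, ∀ s t : ℝ, 0 ≤ s → s ≤ t →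
      F (Finv (s • z)) ≤ F (Finv (t • z)) := by
    intro z s t hs hst
    rcases hst.eq_or_lt with rfl | hlt
    · exact le_rfl
    have h1 := subgrad_aux hconv hC1 (Finv (s • z)) (Finv (t • z))
    have h2 := subgrad_aux hconv hC1 (Finv (t • z)) (Finv (s • z))
    rw [hri, real_inner_smul_left] at h1 h2
    rw [← neg_sub, inner_neg_right] at h2
    set a := inner ℝ z (Finv (t • z) - Finv (s • z))
    have ha : 0 ≤ a := by
      by_contra hneg
      push Not at hneg
      nlinarith
    nlinarith [mul_nonneg hs ha]
  refine ⟨mono, fun k _ z hz t ht => ?_⟩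
  have h := mono z t 1 ht.1 ht.2
  rw [one_smul] at h
  exact h.trans hz
end
end
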